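/- Corollary (limsup version of Theorem B): Let {f_k} be a C¹-uniformly equicontinuous and C¹-uniformly bounded sequence of C¹ maps f_k : I₀ → I₀ with p = sup_k #𝒞_k < ∞, and suppose there is λ > 0 and a set H with limsup_{n→∞} (1/n) log |Df^n(x)| > 2λ for all x ∈ H. Then there exists c > 0 such that limsup_{n→∞} (1/n) Σ_{i=1}^n r_i(x) ≥ c for Lebesgue almost every x ∈ H. -/

import Mathlib

open Set MeasureTheory Filter

noncomputable section

/-- `comp f n = f_{n-1} ∘ ⋯ ∘ f_0`, with `comp f 0 = id`. -/
def comp (f : ℕ → ℝ → ℝ) : ℕ → ℝ → ℝ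
  | 0 => id
  | (n + 1) => f n ∘ comp f n

/-- The critical set `𝒞_k` of `f_k` inside the interval `I`. -/
def crit (f : ℕ → ℝ → ℝ) (I : Set ℝ) (k : ℕ) : Set ℝ :=
  {x ∈ I | deriv (f k) x = 0}

/-- `T f I i x`: the maximal (pre)interval in `I` containing `x` such that
`f^j` of it avoids `𝒞_j` for all `j < i`. -/
def T (f : ℕ → ℝ → ℝ) (I : Set ℝ) (i : ℕ) (x : ℝ) : Set ℝ :=
  ⋃₀ {S | S ⊆ I ∧ IsPreconnected S ∧ x ∈ S ∧
      ∀ j < i, ∀ y ∈ S, comp f j y ∉ crit f I j}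

/-- `r f I i x`: the minimum of the lengths of the images under `f^i` of the
two connected components of `T f I i x \ {x}`. -/
def r (f : ℕ → ℝ → ℝ) (I : Set ℝ) (i : ℕ) (x : ℝ) : ℝ :=
  min (Metric.diam (comp f i '' (T f I i x ∩ Iio x)))
      (Metric.diam (comp f i '' (T f I i x ∩ Ioi x)))


/-- `Dcomp f n x = ∏_{j<n} f_j'(f^j(x))`, the derivative of `f^n` at `x` by the chain rule. -/
def Dcomp (f : ℕ → ℝ → ℝ) (n : ℕ) (x : ℝ) : ℝ :=
  ∏ j ∈ Finset.range n, deriv (f j) (comp f j x)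

/-- `A_n(δ) = {x ∈ I : (1/n) Σ_{i=1}^n r_i(x) < δ², r_n(x) > 0}`. -/
def Aset (f : ℕ → ℝ → ℝ) (I : Set ℝ) (n : ℕ) (δ : ℝ) : Set ℝ :=
  {x ∈ I | (1 / (n : ℝ)) * ∑ i ∈ Finset.Icc 1 n, r f I i x < δ ^ 2 ∧ 0 < r f I n x}

/-- `Y_n(λ) = {x ∈ I : (1/n) log |Df^n(x)| > λ}`. -/
def Yset (f : ℕ → ℝ → ℝ) (I : Set ℝ) (n : ℕ) (lam : ℝ) : Set ℝ :=
  {x ∈ I | lam < (1 / (n : ℝ)) * Real.log |Dcomp f n x|}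


/-! ### Helper material -/

structure Setup (a b G : ℝ) (f : ℕ → ℝ → ℝ) (p : ℕ) : Prop where
  C1 : ∀ k, ContDiff ℝ 1 (f k)
  maps : ∀ k, MapsTo (f k) (Icc a b) (Icc a b)
  der : ∀ k, ∀ x ∈ Icc a b, |deriv (f k) x| ≤ G
  hG : 1 ≤ G
  fin : ∀ k, (crit f (Icc a b) k).Finite ∧ (crit f (Icc a b) k).ncard ≤ p

/-- `x` and `y` lie in a common interval on which `f^j`, `j < i`, avoids critical points. -/
def RR (f : ℕ → ℝ → ℝ) (a b : ℝ) (i : ℕ) (x y : ℝ) : Prop :=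
  ∀ z ∈ uIcc x y, z ∈ Icc a b ∧ ∀ j < i, deriv (f j) (comp f j z) ≠ 0

def Cov (f : ℕ → ℝ → ℝ) (a b : ℝ) (i : ℕ) (E : Set ℝ) (N : ℕ) : Prop :=
  ∃ F : Finset ℝ, F.card ≤ N ∧ ∀ x ∈ E, ∃ y ∈ F, RR f a b i y x

section helpers

variable {a b G : ℝ} {f : ℕ → ℝ → ℝ} {p : ℕ}

lemma RR.symm {i x y} (h : RR f a b i x y) : RR f a b i y x := by
  intro z hz; rw [uIcc_comm] at hz; exact h z hz

lemma RR.trans {i x y w} (h : RR f a b i x y) (h' : RR f a b i y w) : RR f a b i x w := by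
  intro z hz
  rcases uIcc_subset_uIcc_union_uIcc (b := y) hz with hz | hz
  · exact h z hz
  · exact h' z hz

lemma RR.right {i x y} (h : RR f a b i x y) : RR f a b i y y := h.symm.trans h

lemma RR.sub {i x y z} (h : RR f a b i x y) (hz : z ∈ uIcc x y) : RR f a b i x z := by
  intro w hw
  exact h w (uIcc_subset_uIcc_left hz hw)

lemma RR.mono {i j x y} (h : RR f a b i x y) (hij : j ≤ i) : RR f a b j x y :=
  fun z hz => ⟨(h z hz).1, fun k hk => (h z hz).2 k (by omega)⟩

lemma comp_maps (S : Setup a b G f p) (n : ℕ) : MapsTo (comp f n) (Icc a b) (Icc a b) := by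
  induction n with
  | zero => intro x hx; exact hx
  | succ n ih => intro x hx; exact S.maps n (ih hx)

lemma comp_deriv (S : Setup a b G f p) (n : ℕ) (x : ℝ) :
    HasDerivAt (comp f n) (Dcomp f n x) x := by
  induction n with
  | zero => simpa [comp, Dcomp] using hasDerivAt_id x
  | succ n ih =>
    have h1 : HasDerivAt (f n) (deriv (f n) (comp f n x)) (comp f n x) :=
      (((S.C1 n).differentiable (by norm_num)) _).hasDerivAt
    have := h1.comp x ih
    simp only [comp, Dcomp, Finset.prod_range_succ] at this ⊢
    rw [mul_comm]; exact this

lemma comp_cont (S : Setup a b G f p) (n : ℕ) : Continuous (comp f n) :=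
  continuous_iff_continuousAt.2 fun x => (comp_deriv S n x).continuousAt

lemma comp_injOn (S : Setup a b G f p) (n : ℕ) (y : ℝ) :
    InjOn (comp f n) {x | RR f a b n y x} := by
  have key : ∀ u v, RR f a b n u v → u < v → comp f n u ≠ comp f n v := by
    intro u v h huv he
    obtain ⟨c, hc, hc0⟩ := exists_hasDerivAt_eq_zero huv (comp_cont S n).continuousOn he
      (fun x _ => comp_deriv S n x)
    rw [Dcomp, Finset.prod_eq_zero_iff] at hc0
    obtain ⟨j, hj, hj0⟩ := hc0
    exact (h c (by rw [uIcc_of_le huv.le]; exact ⟨hc.1.le, hc.2.le⟩)).2 j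
      (Finset.mem_range.1 hj) hj0
  intro u hu v hv he
  have huv : RR f a b n u v := RR.trans (RR.symm hu) hv
  rcases lt_trichotomy u v with h | h | h
  · exact absurd he (key u v huv h)
  · exact h
  · exact absurd he.symm (key v u huv.symm h)

lemma Cov.mono {i E E' N N'} (h : Cov f a b i E N) (hE : E' ⊆ E) (hN : N ≤ N') :
    Cov f a b i E' N' := by
  obtain ⟨F, h1, h2⟩ := h
  exact ⟨F, h1.trans hN, fun x hx => h2 x (hE hx)⟩

lemma Cov.union {i E E' N N'} (h : Cov f a b i E N) (h' : Cov f a b i E' N') :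
    Cov f a b i (E ∪ E') (N + N') := by
  classical
  obtain ⟨F, h1, h2⟩ := h
  obtain ⟨F', h1', h2'⟩ := h'
  refine ⟨F ∪ F', (Finset.card_union_le _ _).trans (by omega), ?_⟩
  rintro x (hx | hx)
  · obtain ⟨y, hy, h⟩ := h2 x hx
    exact ⟨y, Finset.mem_union_left _ hy, h⟩
  · obtain ⟨y, hy, h⟩ := h2' x hx
    exact ⟨y, Finset.mem_union_right _ hy, h⟩

lemma cov_label {i E} (L : ℕ) (g : ℝ → ℕ) (hg : ∀ x ∈ E, g x < L)
    (h : ∀ x ∈ E, ∀ x' ∈ E, g x = g x' → RR f a b i x x') : Cov f a b i E L := by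
  classical
  refine ⟨(Finset.range L).image
    (fun l => if h : ∃ x ∈ E, g x = l then h.choose else 0), ?_, ?_⟩
  · exact Finset.card_image_le.trans (by simp)
  · intro x hx
    have hex : ∃ x' ∈ E, g x' = g x := ⟨x, hx, rfl⟩
    refine ⟨hex.choose, ?_, h _ hex.choose_spec.1 _ hx hex.choose_spec.2⟩
    rw [Finset.mem_image]
    exact ⟨g x, Finset.mem_range.2 (hg x hx), by rw [dif_pos hex]⟩

lemma cov_bind {i i' E E' N L} (h : Cov f a b i E N) (hE : E' ⊆ E)
    (h' : ∀ y, Cov f a b i' (E' ∩ {x | RR f a b i y x}) L) : Cov f a b i' E' (L * N) := by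
  classical
  obtain ⟨F, h1, h2⟩ := h
  choose F' h1' h2' using h'
  refine ⟨F.biUnion F', ?_, ?_⟩
  · refine (Finset.card_biUnion_le_card_mul _ _ L (fun y _ => h1' y)).trans ?_
    rw [mul_comm]; exact Nat.mul_le_mul_left _ h1
  · intro x hx
    obtain ⟨y, hy, hxy⟩ := h2 x (hE hx)
    obtain ⟨w, hw, hxw⟩ := h2' y x ⟨hx, hxy⟩
    exact ⟨w, Finset.mem_biUnion.2 ⟨y, hy, hw⟩, hxw⟩

lemma cov_step (S : Setup a b G f p) (i : ℕ) (y : ℝ) :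
    Cov f a b (i + 1) ({x | RR f a b (i + 1) x x} ∩ {x | RR f a b i y x}) (p + 1) := by
  set P : Set ℝ := {c | RR f a b i y c ∧ comp f i c ∈ crit f (Icc a b) i} with hP
  have hinj : InjOn (comp f i) P := (comp_injOn S i y).mono (fun c hc => hc.1)
  have hmap : MapsTo (comp f i) P (crit f (Icc a b) i) := fun c hc => hc.2
  have hfin : P.Finite := Set.Finite.of_injOn hmap hinj (S.fin i).1
  have hcard : P.ncard ≤ p :=
    (Set.ncard_le_ncard_of_injOn _ hmap hinj (S.fin i).1).trans (S.fin i).2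
  have key : ∀ x x', RR f a b (i + 1) x x → RR f a b (i + 1) x' x' → RR f a b i y x →
      RR f a b i y x' → x ≤ x' → (P ∩ Iio x).ncard = (P ∩ Iio x').ncard →
      RR f a b (i + 1) x x' := by
    intro x x' hx hx' hyx hyx' hle hn
    have heq : P ∩ Iio x = P ∩ Iio x' := by
      apply Set.eq_of_subset_of_ncard_le _ hn.ge (hfin.subset inter_subset_left)
      intro c hc; exact ⟨hc.1, lt_of_lt_of_le hc.2 hle⟩
    have hxx' : RR f a b i x x' := hyx.symm.trans hyx'
    intro z hz
    refine ⟨(hxx' z hz).1, fun j hj => ?_⟩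
    rcases Nat.lt_succ_iff_lt_or_eq.1 hj with hj | rfl
    · exact (hxx' z hz).2 j hj
    · intro h0
      have hzP : z ∈ P := ⟨hyx.trans (hxx'.sub hz), comp_maps S _ (hxx' z hz).1, h0⟩
      rw [uIcc_of_le hle] at hz
      have hne : z ≠ x' := by
        rintro rfl
        exact (hx' z (by simp)).2 _ (Nat.lt_succ_self _) h0
      have : z ∈ P ∩ Iio x := by
        rw [heq]; exact ⟨hzP, lt_of_le_of_ne hz.2 hne⟩
      exact absurd this.2 (not_lt.2 hz.1)
  apply cov_label (p + 1) (fun x => (P ∩ Iio x).ncard)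
  · intro x _
    exact Nat.lt_succ_of_le ((Set.ncard_le_ncard inter_subset_left hfin).trans hcard)
  · rintro x ⟨hx, hyx⟩ x' ⟨hx', hyx'⟩ hn
    rcases le_total x x' with h | h
    · exact key x x' hx hx' hyx hyx' h hn
    · exact (key x' x hx' hx hyx' hyx h hn.symm).symm

lemma cov_steps (S : Setup a b G f p) (i m : ℕ) (y : ℝ) :
    Cov f a b (i + m) ({x | RR f a b (i + m) x x} ∩ {x | RR f a b i y x}) ((p + 1) ^ m) := by
  induction m with
  | zero => exact ⟨{y}, by simp, fun x hx => ⟨y, by simp, hx.2⟩⟩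
  | succ m ih =>
    rw [pow_succ, mul_comm]
    apply cov_bind (i := i + m) ih
    · rintro x ⟨h1, h2⟩; exact ⟨RR.mono h1 (by omega), h2⟩
    · intro w
      exact (cov_step S (i + m) w).mono (fun x hx => ⟨hx.1.1, hx.2⟩) le_rfl

lemma f_lip (S : Setup a b G f p) (k : ℕ) {x y : ℝ} (hx : x ∈ Icc a b) (hy : y ∈ Icc a b) :
    |f k x - f k y| ≤ G * |x - y| := by
  have := (convex_Icc a b).norm_image_sub_le_of_norm_deriv_le (f := f k) (C := G)
    (fun z _ => ((S.C1 k).differentiable (by norm_num)) z)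
    (fun z hz => by simpa using S.der k z hz) hy hx
  simpa using this

/-- closeness propagates to nonvanishing derivatives. -/
lemma near_reg (S : Setup a b G f p) {i M : ℕ} {ζ η δ : ℝ}
    (hζ : ∀ k, ∀ x ∈ Icc a b, ∀ y ∈ Icc a b, |x - y| < η →
      |deriv (f k) x - deriv (f k) y| < ζ) (hδ : 0 ≤ δ)
    (hM : G ^ M * δ < η) {x z : ℝ} (hx : x ∈ Icc a b) (hz : z ∈ Icc a b)
    (hxz : |comp f i z - comp f i x| ≤ δ)
    (hd : ∀ j, i ≤ j → j < i + M → ζ ≤ |deriv (f j) (comp f j x)|) :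
    ∀ j, i ≤ j → j < i + M → deriv (f j) (comp f j z) ≠ 0 := by
  have hm : ∀ m, |comp f (i + m) z - comp f (i + m) x| ≤ G ^ m * δ := by
    intro m
    induction m with
    | zero => simpa using hxz
    | succ m ih =>
      have := f_lip S (i + m) (comp_maps S (i + m) hz) (comp_maps S (i + m) hx)
      have hG0 : 0 ≤ G := zero_le_one.trans S.hG
      calc _ ≤ G * |comp f (i + m) z - comp f (i + m) x| := this
        _ ≤ G * (G ^ m * δ) := by gcongr
        _ = _ := by ring
  intro j hij hj h0
  obtain ⟨m, rfl⟩ := Nat.exists_eq_add_of_le hij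
  have h1 : |comp f (i + m) z - comp f (i + m) x| < η := by
    refine (hm m).trans_lt (lt_of_le_of_lt ?_ hM)
    have : G ^ m ≤ G ^ M := pow_le_pow_right₀ S.hG (by omega)
    gcongr
  have h2 := hζ (i + m) _ (comp_maps S _ hz) _ (comp_maps S _ hx) h1
  rw [h0, zero_sub, abs_neg] at h2
  exact absurd (hd _ hij hj) (not_le.2 h2)

lemma T_bdd (S : Setup a b G f p) (i : ℕ) (x : ℝ) (U : Set ℝ) :
    comp f i '' (T f (Icc a b) i x ∩ U) ⊆ Icc a b := by
  rintro _ ⟨z, ⟨⟨s, hs, hz⟩, -⟩, rfl⟩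
  exact comp_maps S i (hs.1 hz)

lemma mem_T (S : Setup a b G f p) {i : ℕ} {x z : ℝ} (h : RR f a b i x z) :
    z ∈ T f (Icc a b) i x := by
  refine ⟨uIcc x z, ⟨fun w hw => (h w hw).1, isPreconnected_uIcc, left_mem_uIcc, ?_⟩,
    right_mem_uIcc⟩
  intro j hj w hw hc
  exact (h w hw).2 j hj hc.2

lemma side (S : Setup a b G f p) {i : ℕ} {x' x z δ : ℝ} (U : Set ℝ)
    (hU : Metric.diam (comp f i '' (T f (Icc a b) i x ∩ U)) < δ)
    (h : RR f a b i x x') (hz : z ∈ uIcc x x') (hUz : uIcc x x' \ {x} ⊆ U)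
    (hcl : x ∈ closure (T f (Icc a b) i x ∩ U)) :
    |comp f i z - comp f i x| ≤ δ := by
  set A := comp f i '' (T f (Icc a b) i x ∩ U)
  have hb : Bornology.IsBounded A := (Metric.isBounded_Icc a b).subset (T_bdd S i x U)
  have hx : comp f i x ∈ closure A :=
    image_closure_subset_closure_image (comp_cont S i) (mem_image_of_mem _ hcl)
  have hzA : comp f i z ∈ closure A := by
    by_cases hzx : z = x
    · rw [hzx]; exact hx
    · exact subset_closure (mem_image_of_mem _ ⟨mem_T S (h.sub hz), hUz ⟨hz, hzx⟩⟩)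
  have := Metric.dist_le_diam_of_mem hb.closure hzA hx
  rw [Metric.diam_closure, Real.dist_eq] at this
  linarith

lemma cov_good (S : Setup a b G f p) {i M : ℕ} {ζ η δ : ℝ}
    (hζ : ∀ k, ∀ x ∈ Icc a b, ∀ y ∈ Icc a b, |x - y| < η →
      |deriv (f k) x - deriv (f k) y| < ζ) (hδ : 0 ≤ δ)
    (hM : G ^ M * δ < η) (y : ℝ) :
    Cov f a b (i + M) ({x | r f (Icc a b) i x < δ ∧
      ∀ j, i ≤ j → j < i + M → ζ ≤ |deriv (f j) (comp f j x)|} ∩ {x | RR f a b i y x}) 2 := by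
  classical
  have ext : ∀ x x' : ℝ, RR f a b i x x' →
      (∀ j, i ≤ j → j < i + M → ζ ≤ |deriv (f j) (comp f j x)|) →
      (∀ z ∈ uIcc x x', |comp f i z - comp f i x| ≤ δ) → RR f a b (i + M) x x' := by
    intro x x' h hd hn z hz
    refine ⟨(h z hz).1, fun j hj => ?_⟩
    by_cases hji : j < i
    · exact (h z hz).2 j hji
    · exact near_reg S hζ hδ hM (h x left_mem_uIcc).1 (h z hz).1 (hn z hz) hd j (by omega) hj
  have left : ∀ x x' : ℝ, x' < x → RR f a b i x x' →
      (∀ j, i ≤ j → j < i + M → ζ ≤ |deriv (f j) (comp f j x)|) →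
      Metric.diam (comp f i '' (T f (Icc a b) i x ∩ Iio x)) < δ → RR f a b (i + M) x x' := by
    intro x x' hlt h hd hdi
    refine ext x x' h hd fun z hz => side S (Iio x) hdi h hz ?_ ?_
    · rintro w ⟨hw, hwx⟩
      rw [uIcc_of_ge hlt.le] at hw
      exact lt_of_le_of_ne hw.2 hwx
    · have : x ∈ closure (Ioo x' x) := by rw [closure_Ioo hlt.ne]; exact ⟨hlt.le, le_rfl⟩
      refine closure_mono ?_ this
      intro w hw
      exact ⟨mem_T S (h.sub (by rw [uIcc_of_ge hlt.le]; exact ⟨hw.1.le, hw.2.le⟩)), hw.2⟩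
  have right : ∀ x x' : ℝ, x < x' → RR f a b i x x' →
      (∀ j, i ≤ j → j < i + M → ζ ≤ |deriv (f j) (comp f j x)|) →
      Metric.diam (comp f i '' (T f (Icc a b) i x ∩ Ioi x)) < δ → RR f a b (i + M) x x' := by
    intro x x' hlt h hd hdi
    refine ext x x' h hd fun z hz => side S (Ioi x) hdi h hz ?_ ?_
    · rintro w ⟨hw, hwx⟩
      rw [uIcc_of_le hlt.le] at hw
      exact lt_of_le_of_ne hw.1 (Ne.symm hwx)
    · have : x ∈ closure (Ioo x x') := by rw [closure_Ioo hlt.ne]; exact ⟨le_rfl, hlt.le⟩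
      refine closure_mono ?_ this
      intro w hw
      exact ⟨mem_T S (h.sub (by rw [uIcc_of_le hlt.le]; exact ⟨hw.1.le, hw.2.le⟩)), hw.1⟩
  have self : ∀ x : ℝ, RR f a b i x x →
      (∀ j, i ≤ j → j < i + M → ζ ≤ |deriv (f j) (comp f j x)|) → RR f a b (i + M) x x := by
    intro x h hd
    refine ext x x h hd fun z hz => ?_
    have : z = x := by simpa using hz
    simpa [this] using hδ
  apply cov_label 2
    (fun x => if Metric.diam (comp f i '' (T f (Icc a b) i x ∩ Iio x)) < δ then 0 else 1)
  · intro x _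
    split_ifs <;> norm_num
  · rintro x ⟨⟨hr, hd⟩, hyx⟩ x' ⟨⟨hr', hd'⟩, hyx'⟩ hg
    have h : RR f a b i x x' := RR.trans (RR.symm hyx) hyx'
    rw [r, min_lt_iff] at hr hr'
    rcases lt_trichotomy x x' with hlt | rfl | hlt
    · by_cases c : Metric.diam (comp f i '' (T f (Icc a b) i x' ∩ Iio x')) < δ
      · exact (left x' x hlt h.symm hd' c).symm
      · have c' : ¬ Metric.diam (comp f i '' (T f (Icc a b) i x ∩ Iio x)) < δ := by
          intro c'; simp [c, c'] at hg
        exact right x x' hlt h hd (hr.resolve_left c')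
    · exact self x h hd
    · by_cases c : Metric.diam (comp f i '' (T f (Icc a b) i x ∩ Iio x)) < δ
      · exact left x x' hlt h hd c
      · have c' : ¬ Metric.diam (comp f i '' (T f (Icc a b) i x' ∩ Iio x')) < δ := by
          intro c'; simp [c, c'] at hg
        exact (right x' x hlt h.symm hd' (hr'.resolve_left c')).symm

def Good (f : ℕ → ℝ → ℝ) (a b : ℝ) (M : ℕ) (ζ δ : ℝ) (k : ℕ) (x : ℝ) : Prop :=
  r f (Icc a b) (k * M) x < δ ∧
      ∀ j, k * M ≤ j → j < k * M + M → ζ ≤ |deriv (f j) (comp f j x)|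

open Classical in
def badcount (f : ℕ → ℝ → ℝ) (a b : ℝ) (M : ℕ) (ζ δ : ℝ) (K : ℕ) (x : ℝ) : ℕ :=
  ((Finset.range K).filter (fun k => ¬ Good f a b M ζ δ k x)).card

lemma badcount_succ (M : ℕ) (ζ δ : ℝ) (K : ℕ) (x : ℝ) [Decidable (Good f a b M ζ δ K x)] :
    badcount f a b M ζ δ (K + 1) x =
      badcount f a b M ζ δ K x + if Good f a b M ζ δ K x then 0 else 1 := by
  classical
  unfold badcount
  rw [Finset.range_add_one, Finset.filter_insert]
  by_cases h : Good f a b M ζ δ K x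
  · simp [h]
  · simp [h]

lemma count (S : Setup a b G f p) {M : ℕ} {ζ η δ : ℝ}
    (hζ : ∀ k, ∀ x ∈ Icc a b, ∀ y ∈ Icc a b, |x - y| < η →
      |deriv (f k) x - deriv (f k) y| < ζ) (hδ : 0 ≤ δ)
    (hM : G ^ M * δ < η) (K s : ℕ) :
    Cov f a b (K * M) {x | RR f a b (K * M) x x ∧ badcount f a b M ζ δ K x ≤ s}
      (3 ^ K * ((p + 1) ^ M) ^ s) := by
  classical
  induction K generalizing s with
  | zero =>
    have : Cov f a b (0 * M) {x | RR f a b (0 * M) x x ∧ badcount f a b M ζ δ 0 x ≤ s} 1 := by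
      apply cov_label 1 (fun _ => 0) (fun _ _ => one_pos)
      rintro x ⟨hx, -⟩ x' ⟨hx', -⟩ - z hz
      refine ⟨?_, fun j hj => by omega⟩
      exact ordConnected_Icc.uIcc_subset (hx x (by simp)).1 (hx' x' (by simp)).1 hz
    exact this.mono subset_rfl (by simpa using Nat.one_le_pow _ _ (by positivity))
  | succ K ih =>
    rw [Nat.succ_mul]
    set E := {x | RR f a b (K * M + M) x x ∧ badcount f a b M ζ δ (K + 1) x ≤ s} with hE
    have h1 : Cov f a b (K * M + M) (E ∩ {x | Good f a b M ζ δ K x})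
        (2 * (3 ^ K * ((p + 1) ^ M) ^ s)) := by
      apply cov_bind (ih s)
      · rintro x ⟨⟨hx, hb⟩, hg⟩
        rw [badcount_succ, if_pos (show Good f a b M ζ δ K x from hg)] at hb
        exact ⟨hx.mono (by omega), hb⟩
      · intro y
        refine (cov_good S hζ hδ hM y).mono ?_ le_rfl
        rintro x ⟨⟨_, hg⟩, hy⟩
        exact ⟨hg, hy⟩
    have h2 : Cov f a b (K * M + M) (E ∩ {x | ¬ Good f a b M ζ δ K x})
        (3 ^ K * ((p + 1) ^ M) ^ s) := by
      cases s with
      | zero =>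
        refine ⟨∅, by simp, ?_⟩
        rintro x ⟨⟨hx, hb⟩, hg⟩
        rw [badcount_succ, if_neg (show ¬ Good f a b M ζ δ K x from hg)] at hb
        omega
      | succ t =>
        have : Cov f a b (K * M + M) (E ∩ {x | ¬ Good f a b M ζ δ K x})
            ((p + 1) ^ M * (3 ^ K * ((p + 1) ^ M) ^ t)) := by
          apply cov_bind (ih t)
          · rintro x ⟨⟨hx, hb⟩, hg⟩
            rw [badcount_succ, if_neg (show ¬ Good f a b M ζ δ K x from hg)] at hb
            exact ⟨hx.mono (by omega), by omega⟩
          · intro y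
            refine (cov_steps S (K * M) M y).mono ?_ le_rfl
            rintro x ⟨⟨h, _⟩, hy⟩
            exact ⟨h.1, hy⟩
        refine this.mono subset_rfl (le_of_eq ?_)
        ring
    refine (h1.union h2).mono ?_ (le_of_eq (by ring))
    intro x hx
    by_cases hg : Good f a b M ζ δ K x
    · exact Or.inl ⟨hx, hg⟩
    · exact Or.inr ⟨hx, hg⟩

lemma count' (S : Setup a b G f p) {M : ℕ} (hM0 : 0 < M) {ζ η δ : ℝ}
    (hζ : ∀ k, ∀ x ∈ Icc a b, ∀ y ∈ Icc a b, |x - y| < η →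
      |deriv (f k) x - deriv (f k) y| < ζ) (hδ : 0 ≤ δ)
    (hM : G ^ M * δ < η) (n s : ℕ) :
    Cov f a b n {x | RR f a b n x x ∧ badcount f a b M ζ δ (n / M) x ≤ s}
      ((p + 1) ^ M * (3 ^ (n / M) * ((p + 1) ^ M) ^ s)) := by
  apply cov_bind (count S hζ hδ hM (n / M) s)
  · rintro x ⟨h, hb⟩
    exact ⟨h.mono (Nat.div_mul_le_self n M), hb⟩
  · intro y
    have := cov_steps S (n / M * M) (n % M) y
    rw [Nat.div_add_mod'] at this
    exact this.mono (fun x hx => ⟨hx.1.1, hx.2⟩)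
      (Nat.pow_le_pow_right (by omega) (Nat.mod_lt _ hM0).le)

lemma Dcomp_cont (S : Setup a b G f p) (n : ℕ) : Continuous (Dcomp f n) := by
  unfold Dcomp
  exact continuous_finsetProd _ fun j _ =>
    ((S.C1 j).continuous_deriv (by norm_num)).comp (comp_cont S j)

lemma Yset_meas (S : Setup a b G f p) (n : ℕ) (l : ℝ) : MeasurableSet (Yset f (Icc a b) n l) := by
  have hm : Measurable (fun x => (1 / (n : ℝ)) * Real.log |Dcomp f n x|) := by
    have := (Dcomp_cont S n).measurable
    fun_prop
  exact measurableSet_Icc.inter (measurableSet_lt measurable_const hm)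

lemma Yset_reg (S : Setup a b G f p) {n : ℕ} {l x : ℝ} (hl : 0 < l)
    (hx : x ∈ Yset f (Icc a b) n l) : 0 < n ∧ Dcomp f n x ≠ 0 ∧
      Real.exp (n * l) < |Dcomp f n x| ∧ RR f a b n x x := by
  have hlt := hx.2
  have hn : 0 < n := by
    rcases Nat.eq_zero_or_pos n with rfl | h
    · simp at hlt; linarith
    · exact h
  have hD : Dcomp f n x ≠ 0 := by
    intro h; simp [h] at hlt; linarith
  refine ⟨hn, hD, ?_, ?_⟩
  · rw [← Real.lt_log_iff_exp_lt (abs_pos.2 hD)]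
    have hn' : (0 : ℝ) < n := by exact_mod_cast hn
    rw [one_div, inv_mul_eq_div, lt_div_iff₀ hn'] at hlt
    linarith
  · intro z hz
    have : z = x := by simpa using hz
    subst this
    exact ⟨hx.1, fun j hj => Finset.prod_ne_zero_iff.1 hD j (Finset.mem_range.2 hj)⟩

lemma class_measure (S : Setup a b G f p) (n : ℕ) (y : ℝ) {l : ℝ} (hl : 0 < l) :
    volume ({x | RR f a b n y x} ∩ Yset f (Icc a b) n l) ≤
      ENNReal.ofReal (Real.exp (-(n * l)) * (b - a)) := by
  set A := {x | RR f a b n y x} ∩ Yset f (Icc a b) n l with hA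
  have hord : OrdConnected {x | RR f a b n y x} := by
    refine ordConnected_iff_uIcc_subset.2 ?_
    intro u hu v hv z hz
    exact RR.trans hu ((RR.trans (RR.symm hu) hv).sub hz)
  have hmA : MeasurableSet A := hord.measurableSet.inter (Yset_meas S n l)
  have h2 : ∫⁻ x in A, ENNReal.ofReal |Dcomp f n x| = volume (comp f n '' A) := by
    have := lintegral_image_eq_lintegral_abs_deriv_mul (f := comp f n) (f' := Dcomp f n) hmA
      (fun x _ => (comp_deriv S n x).hasDerivWithinAt)
      ((comp_injOn S n y).mono inter_subset_left) (fun _ => 1)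
    simpa using this.symm
  have h3 : volume (comp f n '' A) ≤ ENNReal.ofReal (b - a) := by
    rw [← Real.volume_Icc]
    apply measure_mono
    rintro _ ⟨x, hx, rfl⟩
    exact comp_maps S n hx.2.1
  have h4 : ENNReal.ofReal (Real.exp (n * l)) * volume A ≤
      ∫⁻ x in A, ENNReal.ofReal |Dcomp f n x| := by
    rw [← setLIntegral_const]
    apply setLIntegral_mono' hmA
    intro x hx
    exact ENNReal.ofReal_le_ofReal (Yset_reg S hl hx.2).2.2.1.le
  have h5 : ENNReal.ofReal (Real.exp (n * l)) * volume A ≤ ENNReal.ofReal (b - a) :=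
    h4.trans (h2.le.trans h3)
  calc volume A = ENNReal.ofReal (Real.exp (-(n * l))) *
        (ENNReal.ofReal (Real.exp (n * l)) * volume A) := by
        rw [← mul_assoc, ← ENNReal.ofReal_mul (Real.exp_pos _).le, ← Real.exp_add]; simp
    _ ≤ ENNReal.ofReal (Real.exp (-(n * l))) * ENNReal.ofReal (b - a) := by gcongr
    _ = _ := by rw [← ENNReal.ofReal_mul (Real.exp_pos _).le]

lemma cov_measure (S : Setup a b G f p) {n N : ℕ} {l : ℝ} (hl : 0 < l) {E : Set ℝ}
    (hE : E ⊆ Yset f (Icc a b) n l) (h : Cov f a b n E N) (hab : a ≤ b) :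
    volume E ≤ ENNReal.ofReal (N * (Real.exp (-(n * l)) * (b - a))) := by
  obtain ⟨F, hF, hc⟩ := h
  calc volume E ≤ volume (⋃ y ∈ F, ({x | RR f a b n y x} ∩ Yset f (Icc a b) n l)) := by
        apply measure_mono
        intro x hx
        obtain ⟨y, hy, h⟩ := hc x hx
        exact mem_biUnion hy ⟨h, hE hx⟩
    _ ≤ ∑ y ∈ F, volume ({x | RR f a b n y x} ∩ Yset f (Icc a b) n l) :=
        measure_biUnion_finset_le _ _
    _ ≤ ∑ y ∈ F, ENNReal.ofReal (Real.exp (-(n * l)) * (b - a)) :=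
        Finset.sum_le_sum fun y _ => class_measure S n y hl
    _ = F.card * ENNReal.ofReal (Real.exp (-(n * l)) * (b - a)) := by simp
    _ ≤ N * ENNReal.ofReal (Real.exp (-(n * l)) * (b - a)) := by gcongr
    _ = _ := by
        rw [ENNReal.ofReal_mul (p := (N : ℝ)) (by positivity), ENNReal.ofReal_natCast]

lemma r_nonneg (i : ℕ) (x : ℝ) : 0 ≤ r f (Icc a b) i x :=
  le_min Metric.diam_nonneg Metric.diam_nonneg

lemma r_le (S : Setup a b G f p) (hab : a ≤ b) (i : ℕ) (x : ℝ) : r f (Icc a b) i x ≤ b - a := by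
  refine (min_le_left _ _).trans ?_
  rw [← Real.diam_Icc hab]
  exact Metric.diam_mono (T_bdd S i x _) (Metric.isBounded_Icc a b)

/-- few small derivatives -/
lemma few_small (S : Setup a b G f p) {n : ℕ} {l x Z : ℝ} (hl : 0 < l)
    (hx : x ∈ Yset f (Icc a b) n l) :
    Z * ((Finset.range n).filter
      (fun j => |deriv (f j) (comp f j x)| < Real.exp (-Z))).card ≤ n * Real.log G := by
  classical
  obtain ⟨hn, hD, hlt, hr⟩ := Yset_reg S hl hx
  have hG : 0 < G := zero_lt_one.trans_le S.hG
  have hlG : 0 ≤ Real.log G := Real.log_nonneg S.hG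
  have hne : ∀ j ∈ Finset.range n, deriv (f j) (comp f j x) ≠ 0 :=
    Finset.prod_ne_zero_iff.1 hD
  have hlog : Real.log |Dcomp f n x| =
      ∑ j ∈ Finset.range n, Real.log |deriv (f j) (comp f j x)| := by
    rw [Dcomp, Finset.abs_prod, Real.log_prod]
    intro j hj; exact abs_ne_zero.2 (hne j hj)
  have hpos : 0 < Real.log |Dcomp f n x| := by
    apply Real.log_pos
    refine lt_of_le_of_lt ?_ hlt
    exact Real.one_le_exp (by positivity)
  have hub : ∑ j ∈ Finset.range n, Real.log |deriv (f j) (comp f j x)| ≤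
      ∑ j ∈ Finset.range n, (Real.log G -
        if |deriv (f j) (comp f j x)| < Real.exp (-Z) then Z else 0) := by
    apply Finset.sum_le_sum
    intro j hj
    have h0 := abs_pos.2 (hne j hj)
    split_ifs with h
    · have := Real.log_lt_log h0 h
      rw [Real.log_exp] at this
      linarith
    · rw [sub_zero]
      exact Real.log_le_log h0 (S.der j _ (comp_maps S j hx.1))
  rw [Finset.sum_sub_distrib, ← Finset.sum_filter] at hub
  simp only [Finset.sum_const, Finset.card_range, nsmul_eq_mul] at hub
  linarith

lemma badcount_le (S : Setup a b G f p) {M n : ℕ} (hM0 : 0 < M) {l x Z δ : ℝ} (hl : 0 < l)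
    (hδ : 0 < δ) (hZ : 0 < Z) (hx : x ∈ Yset f (Icc a b) n l)
    (hA : (1 / (n : ℝ)) * ∑ i ∈ Finset.Icc 1 n, r f (Icc a b) i x < δ ^ 2) :
    (badcount f a b M (Real.exp (-Z)) δ (n / M) x : ℝ) ≤ n * δ + 1 + n * Real.log G / Z := by
  classical
  have hn := (Yset_reg S hl hx).1
  have hn' : (0 : ℝ) < n := by exact_mod_cast hn
  set B1 := (Finset.Icc 1 n).filter (fun i => δ ≤ r f (Icc a b) i x) with hB1
  set B2 := (Finset.range n).filter
      (fun j => |deriv (f j) (comp f j x)| < Real.exp (-Z)) with hB2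
  have hc1 : (B1.card : ℝ) ≤ n * δ := by
    have h1 : (B1.card : ℝ) * δ ≤ ∑ i ∈ Finset.Icc 1 n, r f (Icc a b) i x := by
      calc (B1.card : ℝ) * δ = ∑ i ∈ B1, δ := by simp
        _ ≤ ∑ i ∈ B1, r f (Icc a b) i x :=
            Finset.sum_le_sum fun i hi => (Finset.mem_filter.1 hi).2
        _ ≤ _ := Finset.sum_le_sum_of_subset_of_nonneg (Finset.filter_subset _ _)
            fun i _ _ => r_nonneg i x
    rw [one_div, inv_mul_eq_div, div_lt_iff₀ hn'] at hA
    have : (B1.card : ℝ) * δ ≤ (n * δ) * δ := by nlinarith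
    exact le_of_mul_le_mul_right this hδ
  have hc2 : (B2.card : ℝ) ≤ n * Real.log G / Z := by
    rw [le_div_iff₀ hZ, mul_comm]
    exact few_small S hl hx
  have hsub : (Finset.range (n / M)).filter (fun k => ¬ Good f a b M (Real.exp (-Z)) δ k x) ⊆
      ({0} ∪ B1.image (fun i => i / M)) ∪ B2.image (fun j => j / M) := by
    intro k hk
    rw [Finset.mem_filter, Finset.mem_range] at hk
    obtain ⟨hk, hg⟩ := hk
    have hkM : (k + 1) * M ≤ n :=
      (Nat.mul_le_mul_right M hk).trans (Nat.div_mul_le_self n M)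
    rw [Nat.succ_mul] at hkM
    rw [Good, not_and_or] at hg
    rcases hg with hg | hg
    · apply Finset.mem_union_left
      rcases Nat.eq_zero_or_pos k with rfl | hk0
      · simp
      · apply Finset.mem_union_right
        rw [Finset.mem_image]
        refine ⟨k * M, ?_, Nat.mul_div_cancel _ hM0⟩
        rw [hB1, Finset.mem_filter, Finset.mem_Icc]
        exact ⟨⟨Nat.mul_pos hk0 hM0, by omega⟩, not_lt.1 hg⟩
    · push Not at hg
      obtain ⟨j, h1, h2, h3⟩ := hg
      apply Finset.mem_union_right
      rw [Finset.mem_image]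
      refine ⟨j, ?_, ?_⟩
      · rw [hB2, Finset.mem_filter, Finset.mem_range]
        exact ⟨by omega, h3⟩
      · exact Nat.div_eq_of_lt_le h1 (by rw [Nat.succ_mul]; exact h2)
  have hcard : badcount f a b M (Real.exp (-Z)) δ (n / M) x ≤ 1 + B1.card + B2.card := by
    unfold badcount
    refine (Finset.card_le_card (t := ({0} ∪ B1.image (fun i => i / M)) ∪
      B2.image (fun j => j / M)) ?_).trans ((Finset.card_union_le _ _).trans
      (Nat.add_le_add ((Finset.card_union_le _ _).trans
        (Nat.add_le_add (Finset.card_singleton 0).le Finset.card_image_le))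
        Finset.card_image_le))
    · convert hsub
  have : (badcount f a b M (Real.exp (-Z)) δ (n / M) x : ℝ) ≤ 1 + B1.card + B2.card := by
    exact_mod_cast hcard
  linarith

lemma key_bound (S : Setup a b G f p) {M : ℕ} (hM0 : 0 < M) {lam Z η δ : ℝ} (hl : 0 < lam)
    (hab : a ≤ b) (hδ : 0 < δ) (hZ : 0 < Z)
    (hζ : ∀ k, ∀ x ∈ Icc a b, ∀ y ∈ Icc a b, |x - y| < η →
      |deriv (f k) x - deriv (f k) y| < Real.exp (-Z))
    (hM : G ^ M * δ < η)
    (q1 : Real.log 3 / M ≤ lam / 2)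
    (q2 : Real.log G / Z * (M * Real.log (p + 1)) ≤ lam / 4)
    (q3 : δ * (M * Real.log (p + 1)) ≤ lam / 4) (n : ℕ) :
    volume {x | x ∈ Yset f (Icc a b) n (2 * lam) ∧
        (1 / (n : ℝ)) * ∑ i ∈ Finset.Icc 1 n, r f (Icc a b) i x < δ ^ 2} ≤
      ENNReal.ofReal (Real.exp (2 * (M * Real.log (p + 1))) * (b - a) * Real.exp (-lam) ^ n) := by
  set s := ⌊n * δ + 1 + n * Real.log G / Z⌋₊ with hs
  set L := (M : ℝ) * Real.log (p + 1) with hL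
  have hlp : 0 ≤ Real.log ((p : ℝ) + 1) := Real.log_nonneg (by simp)
  have hlG : 0 ≤ Real.log G := Real.log_nonneg S.hG
  have hL0 : 0 ≤ L := by positivity
  have hcov := (count' S hM0 hζ hδ.le hM n s).mono (E' := {x | x ∈ Yset f (Icc a b) n (2 * lam) ∧
        (1 / (n : ℝ)) * ∑ i ∈ Finset.Icc 1 n, r f (Icc a b) i x < δ ^ 2})
      (fun x hx => ⟨(Yset_reg S (by linarith) hx.1).2.2.2,
        Nat.le_floor (badcount_le S hM0 (by linarith) hδ hZ hx.1 hx.2)⟩) le_rfl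
  refine (cov_measure S (by linarith) (fun x hx => hx.1) hcov hab).trans
    (ENNReal.ofReal_le_ofReal ?_)
  have hM' : (0 : ℝ) < M := by exact_mod_cast hM0
  have hQ : ((p : ℝ) + 1) ^ M = Real.exp L := by
    rw [hL, Real.exp_nat_mul, Real.exp_log (by positivity)]
  have h3 : (3 : ℝ) ^ (n / M) = Real.exp ((n / M : ℕ) * Real.log 3) := by
    rw [Real.exp_nat_mul, Real.exp_log (by positivity)]
  have hN : (((p + 1) ^ M * (3 ^ (n / M) * ((p + 1) ^ M) ^ s) : ℕ) : ℝ) =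
      Real.exp (L + ((n / M : ℕ) * Real.log 3 + s * L)) := by
    push_cast
    rw [hQ, h3, ← Real.exp_nat_mul, ← Real.exp_add, ← Real.exp_add]
  rw [hN, ← Real.exp_nat_mul]
  have hba : 0 ≤ b - a := by linarith
  have hfl : (s : ℝ) ≤ n * δ + 1 + n * Real.log G / Z := Nat.floor_le (by positivity)
  have hdiv : ((n / M : ℕ) : ℝ) ≤ n / M := Nat.cast_div_le
  have h30 : 0 ≤ Real.log 3 := Real.log_nonneg (by norm_num)
  have e1 : ((n / M : ℕ) : ℝ) * Real.log 3 ≤ n * (lam / 2) := by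
    calc ((n / M : ℕ) : ℝ) * Real.log 3 ≤ n / M * Real.log 3 := by gcongr
      _ = n * (Real.log 3 / M) := by ring
      _ ≤ _ := by gcongr
  have e2 : (s : ℝ) * L ≤ n * (lam / 4) + L + n * (lam / 4) := by
    calc (s : ℝ) * L ≤ (n * δ + 1 + n * Real.log G / Z) * L := by gcongr
      _ = n * (δ * L) + L + n * (Real.log G / Z * L) := by ring
      _ ≤ _ := by gcongr
  calc _ = Real.exp (L + ((n / M : ℕ) * Real.log 3 + s * L) + -(n * (2 * lam))) * (b - a) := by
        rw [Real.exp_add _ (-(n * (2 * lam)))]; ring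
    _ ≤ Real.exp (2 * L + n * -lam) * (b - a) := by
        refine mul_le_mul_of_nonneg_right (Real.exp_le_exp.2 ?_) hba
        linarith
    _ = _ := by rw [Real.exp_add]; ring

lemma freq_of_limsup {u : ℕ → ℝ} {c : ℝ} (hc : 0 < c) (h : c < limsup u atTop) :
    ∃ᶠ n in atTop, c < u n := by
  by_contra hcon
  rw [not_frequently] at hcon
  have hmem : c ∈ {t | ∀ᶠ n in atTop, u n ≤ t} := by
    filter_upwards [hcon] with n hn using not_lt.1 hn
  rw [limsup_eq] at h
  by_cases hb : BddBelow {t | ∀ᶠ n in atTop, u n ≤ t}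
  · exact absurd (csInf_le hb hmem) (not_le.2 h)
  · rw [Real.sInf_of_not_bddBelow hb] at h
    linarith

end helpers

/-- limsup version of Theorem B: if the limsup exponent exceeds `2λ`
on a set `H`, then for some `c > 0`, for Lebesgue-a.e. `x ∈ H`,
`limsup (1/n) Σ_{i=1}^n r_i(x) ≥ c`. -/
theorem corollary_limsup_of_r_positive
    (a b Γ lam : ℝ) (hab : a ≤ b) (f : ℕ → ℝ → ℝ) (p : ℕ)
    (hC1 : ∀ k, ContDiff ℝ 1 (f k))
    (hmaps : ∀ k, MapsTo (f k) (Icc a b) (Icc a b))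
    (hequi : ∀ ζ > (0 : ℝ), ∃ ε > (0 : ℝ), ∀ k, ∀ x ∈ Icc a b, ∀ y ∈ Icc a b,
      |x - y| < ε → |f k x - f k y| < ζ ∧ |deriv (f k) x - deriv (f k) y| < ζ)
    (hbdd : ∀ k, ∀ x ∈ Icc a b, |f k x| ≤ Γ ∧ |deriv (f k) x| ≤ Γ)
    (hcrit : ∀ k, (crit f (Icc a b) k).Finite ∧ (crit f (Icc a b) k).ncard ≤ p)
    (hlam : 0 < lam) (H : Set ℝ) (hH : H ⊆ Icc a b)
    (hlyap : ∀ x ∈ H, 2 * lam <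
      limsup (fun n : ℕ => (1 / (n : ℝ)) * Real.log |Dcomp f n x|) atTop) :
    ∃ c > (0 : ℝ), ∀ᵐ x ∂(volume.restrict H),
      c ≤ limsup (fun n : ℕ =>
        (1 / (n : ℝ)) * ∑ i ∈ Finset.Icc 1 n, r f (Icc a b) i x) atTop := by
  have hG : ∃ G, Setup a b G f p := ⟨max Γ 1, hC1, hmaps,
    fun k x hx => (hbdd k x hx).2.trans (le_max_left _ _), le_max_right _ _, hcrit⟩
  obtain ⟨G, S⟩ := hG
  have hlp : 0 ≤ Real.log ((p : ℝ) + 1) := Real.log_nonneg (by simp)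
  have hlG : 0 ≤ Real.log G := Real.log_nonneg S.hG
  have hG0 : 0 < G := zero_lt_one.trans_le S.hG
  -- choose M
  obtain ⟨M, hM⟩ := exists_nat_gt (max 1 (Real.log 3 / (lam / 2)))
  have hM1 : (1 : ℝ) < M := (le_max_left _ _).trans_lt hM
  have hM' : (0 : ℝ) < M := by linarith
  have hM0 : 0 < M := by exact_mod_cast hM'
  have q1 : Real.log 3 / M ≤ lam / 2 := by
    have h := (le_max_right _ _).trans_lt hM
    rw [div_lt_iff₀ (by positivity)] at h
    rw [div_le_iff₀ hM']
    linarith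
  set L := (M : ℝ) * Real.log (p + 1) with hL
  have hL0 : 0 ≤ L := by positivity
  -- choose Z
  obtain ⟨Z, hZ, q2⟩ : ∃ Z > 0, Real.log G / Z * L ≤ lam / 4 := by
    refine ⟨Real.log G * L / (lam / 4) + 1, by positivity, ?_⟩
    rw [div_mul_eq_mul_div, div_le_iff₀ (by positivity), mul_add, mul_div_cancel₀ _ (by positivity)]
    linarith
  obtain ⟨η, hη, hζ⟩ := hequi (Real.exp (-Z)) (Real.exp_pos _)
  -- choose δ
  obtain ⟨δ, hδ, hMδ, q3⟩ : ∃ δ > 0, G ^ M * δ < η ∧ δ * L ≤ lam / 4 := by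
    refine ⟨min (η / (2 * G ^ M)) (lam / 4 / (L + 1)), by positivity, ?_, ?_⟩
    · calc G ^ M * min (η / (2 * G ^ M)) (lam / 4 / (L + 1)) ≤ G ^ M * (η / (2 * G ^ M)) := by
            gcongr; exact min_le_left _ _
        _ = η / 2 := by field_simp
        _ < η := by linarith
    · calc min (η / (2 * G ^ M)) (lam / 4 / (L + 1)) * L ≤ lam / 4 / (L + 1) * L := by
            gcongr; exact min_le_right _ _
        _ ≤ lam / 4 / (L + 1) * (L + 1) := by gcongr; linarith
        _ = lam / 4 := by field_simp
  have hbound := key_bound S hM0 hlam hab hδ hZ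
    (fun k x hx y hy h => (hζ k x hx y hy h).2) hMδ q1 q2 q3
  refine ⟨δ ^ 2, by positivity, ?_⟩
  set W : Set ℝ := {x | ∃ᶠ n in atTop, x ∈ Yset f (Icc a b) n (2 * lam)} with hW
  have hWm : MeasurableSet W := by
    have : W = limsup (fun n => Yset f (Icc a b) n (2 * lam)) atTop := by
      ext x; rw [mem_limsup_iff_frequently_mem]; rfl
    rw [this]
    exact MeasurableSet.measurableSet_limsup fun n => Yset_meas S n _
  have hHW : H ⊆ W := by
    intro x hx
    exact (freq_of_limsup (by linarith) (hlyap x hx)).mono fun n hn => ⟨hH hx, hn⟩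
  refine ae_restrict_of_ae_restrict_of_subset hHW ?_
  rw [ae_restrict_iff' hWm]
  have hBC := measure_setOf_frequently_eq_zero (μ := volume)
    (p := fun n x => x ∈ Yset f (Icc a b) n (2 * lam) ∧
        (1 / (n : ℝ)) * ∑ i ∈ Finset.Icc 1 n, r f (Icc a b) i x < δ ^ 2) (by
      refine ne_top_of_le_ne_top ?_ (ENNReal.tsum_le_tsum hbound)
      have hba : 0 ≤ b - a := by linarith
      rw [← ENNReal.ofReal_tsum_of_nonneg (fun n => by positivity)]
      · exact ENNReal.ofReal_ne_top
      · exact (summable_geometric_of_lt_one (Real.exp_pos _).le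
          (by rw [Real.exp_lt_one_iff]; linarith)).mul_left _)
  have hae : ∀ᵐ x, ¬ ∃ᶠ n in atTop, x ∈ Yset f (Icc a b) n (2 * lam) ∧
        (1 / (n : ℝ)) * ∑ i ∈ Finset.Icc 1 n, r f (Icc a b) i x < δ ^ 2 := by
    rw [ae_iff]; simpa only [not_not] using hBC
  filter_upwards [hae] with x hx hxW
  by_contra hlt
  rw [not_le] at hlt
  apply hx
  have hbd : IsBoundedUnder (· ≤ ·) atTop (fun n : ℕ =>
      (1 / (n : ℝ)) * ∑ i ∈ Finset.Icc 1 n, r f (Icc a b) i x) := by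
    refine isBoundedUnder_of ⟨b - a, fun n => ?_⟩
    rcases Nat.eq_zero_or_pos n with rfl | hn
    · simp; linarith
    · have hn' : (0 : ℝ) < n := by exact_mod_cast hn
      rw [one_div, inv_mul_eq_div, div_le_iff₀ hn']
      calc _ ≤ ∑ i ∈ Finset.Icc 1 n, (b - a) := Finset.sum_le_sum fun i _ => r_le S hab i x
        _ = _ := by simp; ring
  have hev := eventually_lt_of_limsup_lt hlt hbd
  exact hxW.and_eventually hev
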